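/- Let T be a tree of bounded valency (there is D such that every vertex has degree at most D). Call a vertex v an essential branching vertex if deleting v from T leaves at least 3 connected components that are unbounded in the graph metric, and call T bushy if there is r ≥ 0 such that every vertex of T lies within distance r of some essential branching vertex. Suppose there exist a metric space Y whose group of surjective isometries acts coboundedly on Y (there is R ≥ 0 such that for all y₁, y₂ ∈ Y there is a surjective isometry φ of Y with d(φ(y₁), y₂) ≤ R) and a quasi-isometry from the vertex set of T (graph metric) to Y. If T is not bushy, then either the vertex set of T is bounded, or T contains a cobounded bi-infinite geodesic: a map γ : ℤ → V(T) with d(γ(m), γ(n)) = |m − n| for all m,n ∈ ℤ, whose image is cobounded in T. -/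

import Mathlib

universe u v

variable {V : Type u} {Y : Type v}

/-- `a` and `b` can be joined in `T` by a path avoiding the vertex `v`. -/
def ReachAvoid (T : SimpleGraph V) (v a b : V) : Prop :=
  ∃ (ha : a ∈ ({v}ᶜ : Set V)) (hb : b ∈ ({v}ᶜ : Set V)),
    (T.induce ({v}ᶜ : Set V)).Reachable ⟨a, ha⟩ ⟨b, hb⟩

/-- The connected component of `u` in `T` minus `v` is unbounded in the graph metric. -/
def UnboundedComponentAvoiding (T : SimpleGraph V) (v u : V) : Prop :=
  ∀ B : ℕ, ∃ w : V, ReachAvoid T v u w ∧ B < T.dist u w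

/-- An essential branching vertex: deleting it leaves at least 3 unbounded connected
components. -/
def IsEssentialBranchingVertex (T : SimpleGraph V) (v : V) : Prop :=
  ∃ u₁ u₂ u₃ : V, u₁ ≠ v ∧ u₂ ≠ v ∧ u₃ ≠ v ∧
    ¬ ReachAvoid T v u₁ u₂ ∧ ¬ ReachAvoid T v u₁ u₃ ∧ ¬ ReachAvoid T v u₂ u₃ ∧
    UnboundedComponentAvoiding T v u₁ ∧ UnboundedComponentAvoiding T v u₂ ∧
    UnboundedComponentAvoiding T v u₃

/-- A tree is bushy if every vertex is within uniformly bounded distance of an essential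
branching vertex. -/
def IsBushy (T : SimpleGraph V) : Prop :=
  ∃ r : ℕ, ∀ u : V, ∃ w : V, IsEssentialBranchingVertex T w ∧ T.dist u w ≤ r

/-- A quasi-isometry from the vertex set of a graph (with the graph metric) to a metric
space. -/
def IsGraphQuasiIsometry (T : SimpleGraph V) [MetricSpace Y] (f : V → Y) : Prop :=
  ∃ μ α : ℝ, 1 ≤ μ ∧ 0 ≤ α ∧
    (∀ u v : V,
      (1 / μ) * (T.dist u v : ℝ) - α ≤ dist (f u) (f v) ∧
      dist (f u) (f v) ≤ μ * (T.dist u v : ℝ) + α) ∧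
    ∀ x : Y, ∃ v : V, dist x (f v) ≤ α

/-- `q` lies on a geodesic of `T` from `a` to `b`. -/
def IsBetween (T : SimpleGraph V) (a q b : V) : Prop :=
  T.dist a q + T.dist q b = T.dist a b

section TreeGeometry

variable {T : SimpleGraph V}

theorem ReachAvoid.symm {v a b : V} (h : ReachAvoid T v a b) : ReachAvoid T v b a := by
  obtain ⟨ha, hb, h⟩ := h
  exact ⟨hb, ha, h.symm⟩

theorem ReachAvoid.trans {v a b c : V} (h : ReachAvoid T v a b) (h' : ReachAvoid T v b c) :
    ReachAvoid T v a c := by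
  obtain ⟨ha, hb, h⟩ := h
  obtain ⟨_, hc, h'⟩ := h'
  exact ⟨ha, hc, h.trans h'⟩

theorem reachAvoid_of_notMem_support {v a b : V} (p : T.Walk a b) (hp : v ∉ p.support) :
    ReachAvoid T v a b :=
  have hs : ∀ x ∈ p.support, x ∈ ({v}ᶜ : Set V) := fun _ hx hxv => hp (hxv ▸ hx)
  ⟨hs _ p.start_mem_support, hs _ p.end_mem_support, ⟨p.induce _ hs⟩⟩

theorem ReachAvoid.exists_walk {v a b : V} (h : ReachAvoid T v a b) :
    ∃ p : T.Walk a b, v ∉ p.support := by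
  obtain ⟨ha, hb, ⟨p⟩⟩ := h
  have hs := p.support_map (SimpleGraph.Embedding.induce ({v}ᶜ : Set V)).toHom
  refine ⟨p.map (SimpleGraph.Embedding.induce ({v}ᶜ : Set V)).toHom, fun hv => ?_⟩
  obtain ⟨x, -, hx⟩ := List.mem_map.1 (hs ▸ hv)
  exact x.2 hx

theorem IsBetween.symm {a q b : V} (h : IsBetween T a q b) : IsBetween T b q a := by
  unfold IsBetween at *
  grind [SimpleGraph.dist_comm]

/-- In a tree, geodesics are exactly the separating sets: `q` is on the geodesic from `a` to `b`
iff it cannot be avoided. -/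
theorem not_reachAvoid_iff (hT : T.IsTree) {a q b : V} :
    ¬ ReachAvoid T q a b ↔ IsBetween T a q b := by
  classical
  constructor
  · intro h
    obtain ⟨p, hp⟩ := hT.connected.exists_walk_length_eq_dist a b
    have hq : q ∈ p.support := by
      by_contra hq
      exact h (reachAvoid_of_notMem_support p hq)
    have h1 := congrArg SimpleGraph.Walk.length (p.take_spec hq)
    rw [SimpleGraph.Walk.length_append] at h1
    have h2 := SimpleGraph.dist_le (p.takeUntil q hq)
    have h3 := SimpleGraph.dist_le (p.dropUntil q hq)
    have h4 := hT.connected.dist_triangle (u := a) (v := q) (w := b)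
    unfold IsBetween
    omega
  · intro h hr
    obtain ⟨w, hw⟩ := hr.exists_walk
    obtain ⟨p₁, h₁⟩ := hT.connected.exists_walk_length_eq_dist a q
    obtain ⟨p₂, h₂⟩ := hT.connected.exists_walk_length_eq_dist q b
    have hp : (p₁.append p₂).IsPath := by
      apply SimpleGraph.Walk.isPath_of_length_eq_dist
      rw [SimpleGraph.Walk.length_append, h₁, h₂]
      exact h
    have heq := (hT.existsUnique_path a b).unique hp w.bypass_isPath
    have : q ∈ (p₁.append p₂).support := by
      rw [SimpleGraph.Walk.mem_support_append_iff]
      exact Or.inl p₁.end_mem_support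
    rw [heq] at this
    exact hw (w.support_bypass_subset_support this)

theorem IsBetween.or (hT : T.IsTree) {a q c : V} (h : IsBetween T a q c) (b : V) :
    IsBetween T a q b ∨ IsBetween T b q c := by
  simp only [← not_reachAvoid_iff hT] at *
  by_contra! hc
  exact h (hc.1.trans hc.2)

theorem SimpleGraph.Connected.exists_adj_isBetween (hT : T.Connected) {a b : V} (h : a ≠ b) :
    ∃ a', T.Adj a a' ∧ IsBetween T a a' b := by
  obtain ⟨p, hp⟩ := hT.exists_walk_length_eq_dist a b
  cases p with
  | nil => exact absurd rfl h
  | @cons _ a' _ hadj p =>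
    refine ⟨a', hadj, ?_⟩
    have h1 := SimpleGraph.dist_le p
    have h2 := SimpleGraph.dist_eq_one_iff_adj.2 hadj
    have h3 := hT.dist_triangle (u := a) (v := a') (w := b)
    rw [SimpleGraph.Walk.length_cons] at hp
    unfold IsBetween
    omega

theorem isBetween_or_of_adj (hT : T.IsTree) {q u : V} (h : T.Adj q u) (c : V) :
    IsBetween T q u c ∨ IsBetween T u q c := by
  have h1 := SimpleGraph.dist_eq_one_iff_adj.2 h
  have h2 := hT.dist_eq_dist_add_one_of_adj c h
  unfold IsBetween
  grind [SimpleGraph.dist_comm]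

theorem reachAvoid_iff_of_adj (hT : T.IsTree) {q u : V} (h : T.Adj q u) {c : V} :
    ReachAvoid T q u c ↔ IsBetween T q u c := by
  rw [← not_iff_not, not_reachAvoid_iff hT]
  have h1 := SimpleGraph.dist_eq_one_iff_adj.2 h
  have h2 := isBetween_or_of_adj hT h c
  unfold IsBetween at *
  grind [SimpleGraph.dist_comm]

theorem isBetween_of_adj_of_ne (hT : T.IsTree) {q u w : V} (hu : T.Adj q u) (hw : T.Adj q w)
    (hne : u ≠ w) : IsBetween T u q w := by
  rw [← not_reachAvoid_iff hT, reachAvoid_iff_of_adj hT hu]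
  have h1 := SimpleGraph.dist_eq_one_iff_adj.2 hu
  have h2 := SimpleGraph.dist_eq_one_iff_adj.2 hw
  have h3 := hT.connected.pos_dist_of_ne hne
  unfold IsBetween
  omega

/-- Every triple of vertices of a tree has a median. -/
theorem exists_median (hT : T.IsTree) (a b c : V) :
    ∃ q, IsBetween T a q b ∧ IsBetween T a q c ∧ IsBetween T b q c := by
  classical
  have hex : ∃ n, ∃ q, IsBetween T a q b ∧ IsBetween T a q c ∧ T.dist q b = n :=
    ⟨_, a, by simp [IsBetween], by simp [IsBetween], rfl⟩
  obtain ⟨q, hqb, hqc, hn⟩ := Nat.find_spec hex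
  refine ⟨q, hqb, hqc, ?_⟩
  by_contra hbc
  have hr : ReachAvoid T q b c := by
    by_contra h
    exact hbc ((not_reachAvoid_iff hT).1 h)
  obtain ⟨u, hadj, hu⟩ := hT.connected.exists_adj_isBetween (a := q) (b := b) (by
    rintro rfl
    simp [IsBetween] at hbc)
  have huc : IsBetween T q u c := by
    rw [← reachAvoid_iff_of_adj hT hadj] at hu ⊢
    exact hu.trans hr
  have h1 := SimpleGraph.dist_eq_one_iff_adj.2 hadj
  have t1 := hT.connected.dist_triangle (u := a) (v := q) (w := u)
  have t2 := hT.connected.dist_triangle (u := a) (v := u) (w := c)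
  have t3 := hT.connected.dist_triangle (u := a) (v := u) (w := b)
  unfold IsBetween at hqb hqc hu huc
  refine Nat.find_min hex (m := T.dist u b) (by omega) ⟨u, ?_, ?_, rfl⟩ <;>
  · unfold IsBetween
    omega

end TreeGeometry

section CoarseBranching

variable {T : SimpleGraph V}

/-- A self-map of the vertex set that distorts distances, from above and from below, by at most
an affine function with coefficients `K`. -/
def IsCoarseEmbedding (T : SimpleGraph V) (K : ℕ) (h : V → V) : Prop :=
  ∀ v w, T.dist (h v) (h w) ≤ K * T.dist v w + K ∧ T.dist v w ≤ K * T.dist (h v) (h w) + K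

theorem exists_isBetween_near_of_isBetween_image (hT : T.IsTree) {L : ℕ} {h : V → V}
    (hL : ∀ v w, T.Adj v w → T.dist (h v) (h w) ≤ L) {a x q : V}
    (hq : IsBetween T (h a) q (h x)) : ∃ i, IsBetween T a i x ∧ T.dist (h i) q ≤ L := by
  induction hn : T.dist a x generalizing a with
  | zero =>
    obtain rfl := hT.connected.dist_eq_zero_iff.1 hn
    refine ⟨a, by simp [IsBetween], ?_⟩
    unfold IsBetween at hq
    rw [SimpleGraph.dist_self] at hq
    omega
  | succ n ih =>
    have hne : a ≠ x := by
      rintro rfl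
      simp at hn
    obtain ⟨b, hab, hb⟩ := hT.connected.exists_adj_isBetween hne
    have h1 := SimpleGraph.dist_eq_one_iff_adj.2 hab
    rcases hq.or hT (h b) with hq | hq
    · refine ⟨a, by simp [IsBetween], ?_⟩
      have := hL a b hab
      unfold IsBetween at hq
      omega
    · unfold IsBetween at hb
      obtain ⟨i, hi, hiq⟩ := ih hq (by omega)
      refine ⟨i, ?_, hiq⟩
      have t1 := hT.connected.dist_triangle (u := a) (v := i) (w := x)
      have t2 := hT.connected.dist_triangle (u := a) (v := b) (w := i)
      unfold IsBetween at hi ⊢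
      omega

/-- Stability of geodesics in trees under coarse embeddings. -/
theorem IsCoarseEmbedding.exists_isBetween_near (hT : T.IsTree) {K : ℕ} {h : V → V}
    (hh : IsCoarseEmbedding T K h) {a x b : V} (hx : IsBetween T a x b) :
    ∃ q, IsBetween T (h a) q (h b) ∧
      T.dist (h x) q ≤ K * (K * (4 * K) + K) + K + 2 * K := by
  have hL : ∀ v w, T.Adj v w → T.dist (h v) (h w) ≤ 2 * K := by
    intro v w hvw
    have := (hh v w).1
    rw [SimpleGraph.dist_eq_one_iff_adj.2 hvw] at this
    omega
  obtain ⟨q, hab, hax, hbx⟩ := exists_median hT (h a) (h b) (h x)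
  refine ⟨q, hab, ?_⟩
  obtain ⟨i, hi, hiq⟩ := exists_isBetween_near_of_isBetween_image hT hL hax
  obtain ⟨j, hj, hjq⟩ := exists_isBetween_near_of_isBetween_image hT hL hbx
  have hij : T.dist (h i) (h j) ≤ 4 * K := by
    have := hT.connected.dist_triangle (u := h i) (v := q) (w := h j)
    rw [SimpleGraph.dist_comm (u := q)] at this
    omega
  have hxi : T.dist x i ≤ T.dist i j := by
    have t1 := hT.connected.dist_triangle (u := a) (v := i) (w := b)
    have t2 := hT.connected.dist_triangle (u := i) (v := j) (w := b)
    unfold IsBetween at hi hj hx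
    have c1 := T.dist_comm (u := j) (v := b)
    have c2 := T.dist_comm (u := x) (v := b)
    have c3 := T.dist_comm (u := x) (v := i)
    omega
  have h1 := (hh i j).2
  have h2 := (hh x i).1
  have t := hT.connected.dist_triangle (u := h x) (v := h i) (w := q)
  have h3 : K * T.dist (h i) (h j) ≤ K * (4 * K) := Nat.mul_le_mul_left _ hij
  have h4 : K * T.dist x i ≤ K * (K * (4 * K) + K) := Nat.mul_le_mul_left _ (by omega)
  omega

/-- At every scale there are `k` vertices far from `y` whose pairwise geodesics pass within
distance `R` of `y`. -/
def IsCoarselyBranching (T : SimpleGraph V) (k : ℕ) (y : V) (R : ℕ) : Prop :=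
  ∀ N : ℕ, ∃ a : Fin k → V, (∀ i, N ≤ T.dist y (a i)) ∧
    ∀ i j, i ≠ j → ∃ q, IsBetween T (a i) q (a j) ∧ T.dist y q ≤ R

/-- At every scale there are `k` vertices far from `q`, pairwise separated by `q`. -/
def IsBranching (T : SimpleGraph V) (k : ℕ) (q : V) : Prop :=
  ∀ N : ℕ, ∃ a : Fin k → V, (∀ i, N ≤ T.dist q (a i)) ∧
    ∀ i j, i ≠ j → IsBetween T (a i) q (a j)

/-- `u` lies on arbitrarily long geodesics starting at `q`. -/
def IsUnboundedDirection (T : SimpleGraph V) (q u : V) : Prop :=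
  ∀ N : ℕ, ∃ a, IsBetween T q u a ∧ N ≤ T.dist q a

theorem exists_forall_of_antitone {β : Type*} {S : Set β} (hS : S.Finite) {Q : ℕ → β → Prop}
    (hQ : ∀ b m n, m ≤ n → Q n b → Q m b) (h : ∀ n, ∃ b ∈ S, Q n b) :
    ∃ b ∈ S, ∀ n, Q n b := by
  by_contra! hc
  choose! F hF using hc
  obtain ⟨b, hb, hQb⟩ := h (hS.toFinset.sup F)
  exact hF b hb (hQ b _ _ (Finset.le_sup (hS.mem_toFinset.2 hb)) hQb)

theorem finite_setOf_dist_le (hT : T.Connected) (hfin : ∀ v, (T.neighborSet v).Finite) (x : V)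
    (R : ℕ) : {z | T.dist x z ≤ R}.Finite := by
  induction R with
  | zero =>
    refine (Set.finite_singleton x).subset fun z hz => ?_
    exact (hT.dist_eq_zero_iff.1 (Nat.le_zero.1 hz)).symm
  | succ R ih =>
    refine ((Set.finite_singleton x).union
      (ih.biUnion fun z _ => hfin z)).subset fun z hz => ?_
    by_cases hzx : z = x
    · exact Or.inl hzx
    · obtain ⟨w, hzw, hw⟩ := hT.exists_adj_isBetween hzx
      refine Or.inr (Set.mem_biUnion (x := w) ?_ hzw.symm)
      have h1 := SimpleGraph.dist_eq_one_iff_adj.2 hzw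
      have c1 := T.dist_comm (u := x) (v := z)
      have c2 := T.dist_comm (u := x) (v := w)
      simp only [Set.mem_ofPred_eq] at hz ⊢
      unfold IsBetween at hw
      omega

/-- Any vertex can be moved within distance `K` of any other one by a coarse embedding with
coefficients `K`. -/
def IsCoarselyHomogeneous (T : SimpleGraph V) (K : ℕ) : Prop :=
  ∀ x y, ∃ h : V → V, IsCoarseEmbedding T K h ∧ T.dist (h x) y ≤ K

theorem IsCoarselyHomogeneous.exists_isCoarselyBranching (hT : T.IsTree) {K : ℕ}
    (hK : IsCoarselyHomogeneous T K) {k : ℕ}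
    (hx : ∀ N : ℕ, ∃ (x : V) (a : Fin k → V), (∀ i, N ≤ T.dist x (a i)) ∧
      ∀ i j, i ≠ j → IsBetween T (a i) x (a j)) :
    ∃ R, ∀ y, IsCoarselyBranching T k y R := by
  refine ⟨K * (K * (4 * K) + K) + K + 2 * K + K, fun y N => ?_⟩
  obtain ⟨x, a, ha, hax⟩ := hx (K * (N + K) + K + 1)
  obtain ⟨h, hh, hxy⟩ := hK x y
  refine ⟨h ∘ a, fun i => ?_, fun i j hij => ?_⟩
  · have h1 := (hh x (a i)).2
    have h2 := hT.connected.dist_triangle (u := h x) (v := y) (w := h (a i))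
    have h3 := ha i
    simp only [Function.comp_apply]
    by_contra! hlt
    have h4 : K * T.dist (h x) (h (a i)) ≤ K * (N + K) := Nat.mul_le_mul_left _ (by omega)
    omega
  · obtain ⟨q, hq, hxq⟩ := hh.exists_isBetween_near hT (hax i j hij)
    refine ⟨q, hq, ?_⟩
    have h2 := hT.connected.dist_triangle (u := y) (v := h x) (w := q)
    rw [SimpleGraph.dist_comm (u := y) (v := h x)] at h2
    omega

theorem exists_isBetween_dist_eq (hT : T.Connected) {a b : V} {n : ℕ} (hn : n ≤ T.dist a b) :
    ∃ x, IsBetween T a x b ∧ T.dist a x = n := by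
  induction n with
  | zero => exact ⟨a, by simp [IsBetween], by simp⟩
  | succ n ih =>
    obtain ⟨x, hx, hxn⟩ := ih (by omega)
    unfold IsBetween at hx
    obtain ⟨x', hadj, hx'⟩ := hT.exists_adj_isBetween (a := x) (b := b) (by
      rintro rfl
      simp at hx
      omega)
    have h1 := SimpleGraph.dist_eq_one_iff_adj.2 hadj
    have t1 := hT.dist_triangle (u := a) (v := x) (w := x')
    have t2 := hT.dist_triangle (u := a) (v := x') (w := b)
    unfold IsBetween at hx'
    refine ⟨x', ?_, by omega⟩
    unfold IsBetween
    omega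

theorem exists_far_pair_isBetween (hT : T.Connected) (hunb : ∀ B : ℕ, ∃ u w, B < T.dist u w)
    (N : ℕ) : ∃ (x : V) (a : Fin 2 → V), (∀ i, N ≤ T.dist x (a i)) ∧
      ∀ i j, i ≠ j → IsBetween T (a i) x (a j) := by
  obtain ⟨u, w, huw⟩ := hunb (2 * N)
  obtain ⟨x, hx, hux⟩ := exists_isBetween_dist_eq hT (a := u) (b := w) (n := N) (by omega)
  refine ⟨x, ![u, w], ?_, ?_⟩
  · have c := T.dist_comm (u := x) (v := u)
    unfold IsBetween at hx
    simp only [Fin.forall_fin_two, Matrix.cons_val_zero, Matrix.cons_val_one]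
    omega
  · simp [Fin.forall_fin_two, hx, hx.symm]

theorem dist_le_of_isBetween (hT : T.IsTree) {y q a b z : V} (hya : IsBetween T y q a)
    (hyb : IsBetween T y q b) (hab : IsBetween T a q b) (hz : IsBetween T a z b) :
    T.dist y q ≤ T.dist y z := by
  have key : IsBetween T y q z ∨ z = q := by
    by_contra! hc
    have hza := (hya.or hT z).resolve_left hc.1
    have hzb := (hyb.or hT z).resolve_left hc.1
    have := hT.connected.pos_dist_of_ne hc.2
    have c1 := T.dist_comm (u := z) (v := a)
    have c2 := T.dist_comm (u := q) (v := a)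
    have c3 := T.dist_comm (u := z) (v := q)
    unfold IsBetween at *
    omega
  rcases key with h | rfl
  · unfold IsBetween at h
    omega
  · exact le_rfl

theorem IsCoarselyBranching.exists_near_two {y : V} {R : ℕ}
    (hT : T.Connected) (h : IsCoarselyBranching T 2 y R) (N : ℕ) :
    ∃ (q : V) (a : Fin 2 → V), T.dist y q ≤ R ∧ (∀ i, N ≤ T.dist q (a i)) ∧
      ∀ i j, i ≠ j → IsBetween T (a i) q (a j) := by
  obtain ⟨a, ha, hb⟩ := h (N + R)
  obtain ⟨q, hq, hyq⟩ := hb 0 1 (by decide)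
  refine ⟨q, a, hyq, fun i => ?_, ?_⟩
  · have := hT.dist_triangle (u := y) (v := q) (w := a i)
    have := ha i
    omega
  · simp [Fin.forall_fin_two, hq, hq.symm]

theorem IsCoarselyBranching.exists_near_three {y : V} {R : ℕ}
    (hT : T.IsTree) (h : IsCoarselyBranching T 3 y R) (N : ℕ) :
    ∃ (q : V) (a : Fin 3 → V), T.dist y q ≤ R ∧ (∀ i, N ≤ T.dist q (a i)) ∧
      ∀ i j, i ≠ j → IsBetween T (a i) q (a j) := by
  obtain ⟨a, ha, hb⟩ := h (N + R)
  obtain ⟨q, h01, h02, h12⟩ := exists_median hT (a 0) (a 1) (a 2)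
  have hq : ∀ i j, i ≠ j → IsBetween T (a i) q (a j) := by
    simp [Fin.forall_fin_succ, h01, h02, h12, h01.symm, h02.symm, h12.symm]
  have hyq : T.dist y q ≤ R := by
    have hpair : ∃ i j, i ≠ j ∧ IsBetween T y q (a i) ∧ IsBetween T y q (a j) := by
      rcases h01.or hT y with h | h
      · rcases h12.or hT y with h' | h'
        · exact ⟨0, 1, by decide, h.symm, h'.symm⟩
        · exact ⟨0, 2, by decide, h.symm, h'⟩
      · rcases h02.or hT y with h' | h'
        · exact ⟨1, 0, by decide, h, h'.symm⟩
        · exact ⟨1, 2, by decide, h, h'⟩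
    obtain ⟨i, j, hij, hi, hj⟩ := hpair
    obtain ⟨z, hz, hyz⟩ := hb i j hij
    exact (dist_le_of_isBetween hT hi hj (hq i j hij) hz).trans hyz
  refine ⟨q, a, hyq, fun i => ?_, hq⟩
  have := hT.connected.dist_triangle (u := y) (v := q) (w := a i)
  have := ha i
  omega

/-- By local finiteness, vertices pairwise separated at every scale by some `q` in a fixed ball
yield distinct unbounded directions at a single `q` in that ball. -/
theorem exists_unboundedDirections (hT : T.IsTree) (hfin : ∀ v, (T.neighborSet v).Finite)
    {k : ℕ} {y : V} {R : ℕ}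
    (h : ∀ N : ℕ, ∃ (q : V) (a : Fin k → V), T.dist y q ≤ R ∧ (∀ i, N ≤ T.dist q (a i)) ∧
      ∀ i j, i ≠ j → IsBetween T (a i) q (a j)) :
    ∃ (q : V) (u : Fin k → V), T.dist y q ≤ R ∧ Function.Injective u ∧
      ∀ i, T.Adj q (u i) ∧ IsUnboundedDirection T q (u i) := by
  let S : Set (V × (Fin k → V)) :=
    {q | T.dist y q ≤ R} ×ˢ Set.pi Set.univ fun _ => {u | T.dist y u ≤ R + 1}
  have hS : S.Finite := (finite_setOf_dist_le hT.connected hfin y R).prod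
    (Set.Finite.pi fun _ => finite_setOf_dist_le hT.connected hfin y (R + 1))
  let Q : ℕ → V × (Fin k → V) → Prop := fun N p => Function.Injective p.2 ∧
    ∀ i, T.Adj p.1 (p.2 i) ∧ ∃ a, IsBetween T p.1 (p.2 i) a ∧ N ≤ T.dist p.1 a
  have hex : ∃ p ∈ S, ∀ n, Q n p := by
    refine exists_forall_of_antitone hS ?_ fun N => ?_
    · rintro p m n hmn ⟨hinj, hp⟩
      refine ⟨hinj, fun i => ⟨(hp i).1, ?_⟩⟩
      obtain ⟨a, ha, hna⟩ := (hp i).2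
      exact ⟨a, ha, hmn.trans hna⟩
    · obtain ⟨q, a, hyq, hqa, hsep⟩ := h (N + 1)
      have hne : ∀ i, q ≠ a i := by
        intro i hi
        have := hqa i
        rw [← hi, SimpleGraph.dist_self] at this
        omega
      choose u hadj hu using fun i => hT.connected.exists_adj_isBetween (hne i)
      refine ⟨(q, u), ⟨hyq, fun i _ => ?_⟩, fun i j hij => ?_, fun i =>
        ⟨hadj i, a i, hu i, (Nat.le_succ N).trans (hqa i)⟩⟩
      · have h1 := SimpleGraph.dist_eq_one_iff_adj.2 (hadj i)
        have h2 := hT.connected.dist_triangle (u := y) (v := q) (w := u i)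
        simp only [Set.mem_ofPred_eq] at hyq ⊢
        omega
      · by_contra hne
        have h1 := (reachAvoid_iff_of_adj hT (hadj i)).2 (hu i)
        have h2 := (reachAvoid_iff_of_adj hT (hadj j)).2 (hu j)
        simp only at hij
        rw [← hij] at h2
        exact (not_reachAvoid_iff hT).2 (hsep i j hne) (h1.symm.trans h2)
  obtain ⟨⟨q, u⟩, ⟨hyq, -⟩, hQ⟩ := hex
  exact ⟨q, u, hyq, (hQ 0).1, fun i => ⟨((hQ 0).2 i).1, fun N => ((hQ N).2 i).2⟩⟩

theorem isEssentialBranchingVertex_of_directions (hT : T.IsTree) {q : V} {u : Fin 3 → V}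
    (hu : Function.Injective u)
    (h : ∀ i, T.Adj q (u i) ∧ IsUnboundedDirection T q (u i)) :
    IsEssentialBranchingVertex T q := by
  have hsep : ∀ i j, i ≠ j → ¬ ReachAvoid T q (u i) (u j) := fun i j hij =>
    (not_reachAvoid_iff hT).2 (isBetween_of_adj_of_ne hT (h i).1 (h j).1 (hu.ne hij))
  have hunb : ∀ i, UnboundedComponentAvoiding T q (u i) := by
    intro i B
    obtain ⟨a, ha, hBa⟩ := (h i).2 (B + 2)
    have h1 := SimpleGraph.dist_eq_one_iff_adj.2 (h i).1
    refine ⟨a, (reachAvoid_iff_of_adj hT (h i).1).2 ha, ?_⟩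
    unfold IsBetween at ha
    omega
  exact ⟨u 0, u 1, u 2, (h 0).1.ne', (h 1).1.ne', (h 2).1.ne', hsep 0 1 (by decide),
    hsep 0 2 (by decide), hsep 1 2 (by decide), hunb 0, hunb 1, hunb 2⟩

theorem IsEssentialBranchingVertex.isBranching (hT : T.IsTree) {v : V}
    (hv : IsEssentialBranchingVertex T v) : IsBranching T 3 v := by
  obtain ⟨u₁, u₂, u₃, -, -, -, h12, h13, h23, hu₁, hu₂, hu₃⟩ := hv
  have far : ∀ u N, UnboundedComponentAvoiding T v u →
      ∃ w, ReachAvoid T v u w ∧ N ≤ T.dist v w := by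
    intro u N hu
    obtain ⟨w, hw, hlt⟩ := hu (N + T.dist u v)
    have := hT.connected.dist_triangle (u := u) (v := v) (w := w)
    exact ⟨w, hw, by omega⟩
  have sep : ∀ {u u' w w'}, ReachAvoid T v u w → ReachAvoid T v u' w' → ¬ ReachAvoid T v u u' →
      IsBetween T w v w' := fun hw hw' hn =>
    (not_reachAvoid_iff hT).1 fun hr => hn ((hw.trans hr).trans hw'.symm)
  intro N
  obtain ⟨w₁, hw₁, hN₁⟩ := far u₁ N hu₁
  obtain ⟨w₂, hw₂, hN₂⟩ := far u₂ N hu₂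
  obtain ⟨w₃, hw₃, hN₃⟩ := far u₃ N hu₃
  have s12 := sep hw₁ hw₂ h12
  have s13 := sep hw₁ hw₃ h13
  have s23 := sep hw₂ hw₃ h23
  refine ⟨![w₁, w₂, w₃], ?_, ?_⟩
  · simp [Fin.forall_fin_succ, hN₁, hN₂, hN₃]
  · simp [Fin.forall_fin_succ, s12, s13, s23, s12.symm, s13.symm, s23.symm]

theorem IsBranching.isEssentialBranchingVertex (hT : T.IsTree)
    (hfin : ∀ v, (T.neighborSet v).Finite) {v : V} (hv : IsBranching T 3 v) :
    IsEssentialBranchingVertex T v := by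
  obtain ⟨q, u, hvq, hu, h⟩ := exists_unboundedDirections hT hfin (y := v) (R := 0) fun N => by
    obtain ⟨a, ha⟩ := hv N
    exact ⟨v, a, by simp, ha⟩
  obtain rfl := hT.connected.dist_eq_zero_iff.1 (Nat.le_zero.1 hvq)
  exact isEssentialBranchingVertex_of_directions hT hu h

end CoarseBranching

section Lines

variable {T : SimpleGraph V}

/-- A bi-infinite geodesic. -/
def IsLine (T : SimpleGraph V) (γ : ℤ → V) : Prop :=
  ∀ m n : ℤ, T.dist (γ m) (γ n) = (m - n).natAbs

theorem IsUnboundedDirection.exists_adj (hT : T.Connected)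
    (hfin : ∀ v, (T.neighborSet v).Finite) {q w : V} (hw : IsUnboundedDirection T q w) :
    ∃ w', T.Adj w w' ∧ T.dist q w' = T.dist q w + 1 ∧ IsUnboundedDirection T q w' := by
  obtain ⟨w', hadj, hw'⟩ := exists_forall_of_antitone (hfin w)
    (Q := fun N w' => T.dist q w' = T.dist q w + 1 ∧ ∃ a, IsBetween T q w' a ∧ N ≤ T.dist q a)
    (by
      rintro b m n hmn ⟨hd, a, ha, hna⟩
      exact ⟨hd, a, ha, hmn.trans hna⟩)
    (fun N => by
      obtain ⟨a, ha, hNa⟩ := hw (N + T.dist q w + 1)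
      obtain ⟨w', hadj, hw'⟩ := hT.exists_adj_isBetween (a := w) (b := a) (by
        rintro rfl
        omega)
      have h1 := SimpleGraph.dist_eq_one_iff_adj.2 hadj
      have t1 := hT.dist_triangle (u := q) (v := w) (w := w')
      have t2 := hT.dist_triangle (u := q) (v := w') (w := a)
      unfold IsBetween at *
      exact ⟨w', hadj, by omega, a, by omega, by omega⟩)
  exact ⟨w', hadj, (hw' 0).1, fun N => (hw' N).2⟩

theorem IsUnboundedDirection.exists_ray (hT : T.Connected)
    (hfin : ∀ v, (T.neighborSet v).Finite) {q u : V} (hadj : T.Adj q u)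
    (hu : IsUnboundedDirection T q u) :
    ∃ s : ℕ → V, s 0 = q ∧ s 1 = u ∧ ∀ m n, m ≤ n → T.dist (s m) (s n) = n - m := by
  choose F hFadj hFdist hFunb using
    fun w : {w // IsUnboundedDirection T q w} => w.2.exists_adj hT hfin
  let r : ℕ → {w // IsUnboundedDirection T q w} := fun n =>
    Nat.rec ⟨u, hu⟩ (fun _ w => ⟨F w, hFunb w⟩) n
  have hrd : ∀ n, T.dist q (r n).1 = n + 1 := by
    intro n
    induction n with
    | zero => exact SimpleGraph.dist_eq_one_iff_adj.2 hadj
    | succ n ih => exact (hFdist (r n)).trans (by rw [ih])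
  let s : ℕ → V := fun n => Nat.casesOn n q fun n => (r n).1
  have hsd : ∀ n, T.dist q (s n) = n := by
    rintro (_ | n)
    · exact SimpleGraph.dist_self
    · exact hrd n
  have hsadj : ∀ n, T.Adj (s n) (s (n + 1)) := by
    rintro (_ | n)
    · exact hadj
    · exact hFadj (r n)
  refine ⟨s, rfl, rfl, fun m n hmn => ?_⟩
  have hle : T.dist (s m) (s n) ≤ n - m := by
    induction n, hmn using Nat.le_induction with
    | base => simp
    | succ n hmn ih =>
      have := hT.dist_triangle (u := s m) (v := s n) (w := s (n + 1))
      rw [SimpleGraph.dist_eq_one_iff_adj.2 (hsadj n)] at this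
      omega
  have := hT.dist_triangle (u := q) (v := s m) (w := s n)
  rw [hsd, hsd] at this
  omega

theorem exists_isLine_of_directions (hT : T.IsTree) (hfin : ∀ v, (T.neighborSet v).Finite)
    {q : V} {u : Fin 2 → V} (hu : Function.Injective u)
    (h : ∀ i, T.Adj q (u i) ∧ IsUnboundedDirection T q (u i)) :
    ∃ γ, IsLine T γ := by
  obtain ⟨s, hs0, hs1, hs⟩ := (h 0).2.exists_ray hT.connected hfin (h 0).1
  obtain ⟨t, ht0, ht1, ht⟩ := (h 1).2.exists_ray hT.connected hfin (h 1).1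
  have hst : ∀ m n, T.dist (s m) (t n) = m + n := by
    rintro (_ | m) (_ | n)
    · simp [hs0, ht0]
    · rw [hs0, ← ht0, ht 0 _ (Nat.zero_le _)]
      omega
    · rw [ht0, ← hs0, SimpleGraph.dist_comm, hs 0 _ (Nat.zero_le _)]
      omega
    · have h1 : ReachAvoid T q (u 0) (s (m + 1)) := by
        rw [reachAvoid_iff_of_adj hT (h 0).1, IsBetween, ← hs0, ← hs1, hs _ _ (by omega),
          hs _ _ (by omega), hs _ _ (by omega)]
        omega
      have h2 : ReachAvoid T q (u 1) (t (n + 1)) := by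
        rw [reachAvoid_iff_of_adj hT (h 1).1, IsBetween, ← ht0, ← ht1, ht _ _ (by omega),
          ht _ _ (by omega), ht _ _ (by omega)]
        omega
      have h3 : IsBetween T (s (m + 1)) q (t (n + 1)) := by
        rw [← not_reachAvoid_iff hT]
        intro h3
        exact (not_reachAvoid_iff hT).2
          (isBetween_of_adj_of_ne hT (h 0).1 (h 1).1 (hu.ne (by decide)))
          ((h1.trans h3).trans h2.symm)
      have h4 := hs 0 (m + 1) (by omega)
      have h5 := ht 0 (n + 1) (by omega)
      rw [hs0, SimpleGraph.dist_comm] at h4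
      rw [ht0] at h5
      unfold IsBetween at h3
      omega
  have hs' : ∀ m n, T.dist (s m) (s n) = ((m : ℤ) - n).natAbs := by
    intro m n
    rcases le_total m n with hmn | hmn
    · rw [hs m n hmn]
      omega
    · rw [SimpleGraph.dist_comm, hs n m hmn]
      omega
  have ht' : ∀ m n, T.dist (t m) (t n) = ((m : ℤ) - n).natAbs := by
    intro m n
    rcases le_total m n with hmn | hmn
    · rw [ht m n hmn]
      omega
    · rw [SimpleGraph.dist_comm, ht n m hmn]
      omega
  refine ⟨fun n => if 0 ≤ n then s n.toNat else t (-n).toNat, fun m n => ?_⟩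
  dsimp only
  split_ifs with hm hn hn
  · rw [hs']
    omega
  · rw [hst]
    omega
  · rw [SimpleGraph.dist_comm, hst]
    omega
  · rw [ht']
    omega

theorem IsLine.eq_of_isBetween (hT : T.IsTree) {γ : ℤ → V} (hγ : IsLine T γ) {j k : ℤ} {z : V}
    (hz : IsBetween T (γ j) z (γ k)) : ∃ i, z = γ i := by
  wlog hjk : j ≤ k generalizing j k
  · exact this hz.symm (le_of_not_ge hjk)
  induction k, hjk using Int.leInduction with
  | base =>
    unfold IsBetween at hz
    rw [SimpleGraph.dist_self] at hz
    exact ⟨j, hT.connected.dist_eq_zero_iff.1 (by omega)⟩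
  | succ k hjk ih =>
    rcases hz.or hT (γ k) with h | h
    · exact ih h
    · have h1 := hγ k (k + 1)
      unfold IsBetween at h
      rcases Nat.eq_zero_or_pos (T.dist (γ k) z) with h0 | h0
      · exact ⟨k, (hT.connected.dist_eq_zero_iff.1 h0).symm⟩
      · exact ⟨k + 1, hT.connected.dist_eq_zero_iff.1 (by omega)⟩

theorem IsLine.exists_projection (hT : T.IsTree) {γ : ℤ → V} (hγ : IsLine T γ) (q : V) :
    ∃ k, ∀ j, IsBetween T q (γ k) (γ j) := by
  obtain ⟨k, hk⟩ : ∃ k, ∀ j, T.dist q (γ k) ≤ T.dist q (γ j) :=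
    ⟨_, fun j => Function.argmin_le (fun k => T.dist q (γ k)) j⟩
  refine ⟨k, fun j => ?_⟩
  obtain ⟨z, hqk, hqj, hkj⟩ := exists_median hT q (γ k) (γ j)
  obtain ⟨i, rfl⟩ := hγ.eq_of_isBetween hT hkj
  have := hk i
  have h0 : γ i = γ k := by
    apply hT.connected.dist_eq_zero_iff.1
    unfold IsBetween at hqk
    omega
  rwa [← h0]

/-- Two unbounded directions at a vertex off a line create a branching vertex on the line. -/
theorem IsLine.isBranching_of_directions (hT : T.IsTree) {γ : ℤ → V} (hγ : IsLine T γ) {q : V}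
    {u : Fin 2 → V} (hu : Function.Injective u)
    (h : ∀ i, T.Adj q (u i) ∧ IsUnboundedDirection T q (u i)) {k : ℤ}
    (hk : ∀ j, IsBetween T q (γ k) (γ j)) (hne : γ k ≠ q) : IsBranching T 3 (γ k) := by
  have hi : ∃ i, ¬ ReachAvoid T q (u i) (γ k) := by
    by_contra! hc
    exact (not_reachAvoid_iff hT).2
      (isBetween_of_adj_of_ne hT (h 0).1 (h 1).1 (hu.ne (by decide))) ((hc 0).trans (hc 1).symm)
  obtain ⟨i, hi⟩ := hi
  intro N
  obtain ⟨a, hua, hNa⟩ := (h i).2 N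
  have hka : IsBetween T (γ k) q a := by
    rw [← not_reachAvoid_iff hT]
    rw [← reachAvoid_iff_of_adj hT (h i).1] at hua
    exact fun hr => hi (hua.trans hr.symm)
  have hsep : ∀ j, IsBetween T a (γ k) (γ j) := by
    intro j
    refine ((hk j).or hT a).resolve_left fun hc => ?_
    have := hT.connected.pos_dist_of_ne hne
    unfold IsBetween at hka hc
    have := T.dist_comm (u := γ k) (v := q)
    omega
  have hline : IsBetween T (γ (k + N)) (γ k) (γ (k - N)) := by
    unfold IsBetween
    rw [hγ, hγ, hγ]
    omega
  have s1 := hsep (k + N)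
  have s2 := hsep (k - N)
  have d0 : N ≤ T.dist (γ k) a := by
    unfold IsBetween at hka
    omega
  have d1 : N ≤ T.dist (γ k) (γ (k + N)) := by
    rw [hγ]
    omega
  have d2 : N ≤ T.dist (γ k) (γ (k - N)) := by
    rw [hγ]
    omega
  refine ⟨![a, γ (k + N), γ (k - N)], ?_, ?_⟩
  · simp [Fin.forall_fin_succ, d0, d1, d2]
  · simp [Fin.forall_fin_succ, s1, s2, hline, s1.symm, s2.symm, hline.symm]

end Lines

/-- A tree quasi-isometric to a metric space with cobounded isometry group is coarsely
homogeneous. -/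
theorem exists_isCoarselyHomogeneous (T : SimpleGraph V) [MetricSpace Y]
    (hcobisom : ∃ R : ℝ, 0 ≤ R ∧ ∀ y₁ y₂ : Y, ∃ φ : Y ≃ᵢ Y, dist (φ y₁) y₂ ≤ R)
    (f : V → Y) (hf : IsGraphQuasiIsometry T f) : ∃ K, IsCoarselyHomogeneous T K := by
  obtain ⟨R, hR, hφ⟩ := hcobisom
  obtain ⟨μ, α, hμ, hα, hqi, hsurj⟩ := hf
  have hμ0 : 0 < μ := by linarith
  have hlow : ∀ v w, (T.dist v w : ℝ) ≤ μ * dist (f v) (f w) + μ * α := by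
    intro v w
    have h1 := (hqi v w).1
    have h2 := mul_le_mul_of_nonneg_left h1 hμ0.le
    have h3 : μ * (1 / μ * (T.dist v w : ℝ) - α) = T.dist v w - μ * α := by
      field_simp
    linarith
  obtain ⟨K, hK⟩ := exists_nat_ge (μ * μ + 4 * μ * α + μ * R + 2 * μ * α)
  have b1 : 0 ≤ μ * α := by positivity
  have b2 : 0 ≤ μ * R := by positivity
  have b3 : 0 ≤ μ * μ := by positivity
  refine ⟨K, fun x y => ?_⟩
  obtain ⟨φ, hxy⟩ := hφ (f x) (f y)
  choose h hh using fun v => hsurj (φ (f v))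
  refine ⟨h, fun v w => ?_, ?_⟩
  · have hd := φ.dist_eq (f v) (f w)
    have hv := hh v
    have hw := hh w
    have t1 := dist_triangle4 (f (h v)) (φ (f v)) (φ (f w)) (f (h w))
    have t2 := dist_triangle4 (φ (f v)) (f (h v)) (f (h w)) (φ (f w))
    rw [dist_comm (f (h v)) (φ (f v))] at t1
    rw [dist_comm (f (h w)) (φ (f w))] at t2
    constructor
    · have e1 := hlow (h v) (h w)
      have e2 : dist (f (h v)) (f (h w)) ≤ μ * T.dist v w + 3 * α := by
        linarith [(hqi v w).2]
      have e3 := mul_le_mul_of_nonneg_left e2 hμ0.le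
      have e4 : μ * μ * (T.dist v w : ℝ) ≤ K * T.dist v w :=
        mul_le_mul_of_nonneg_right (by linarith) (Nat.cast_nonneg _)
      have e5 : (T.dist (h v) (h w) : ℝ) ≤ K * T.dist v w + K := by linarith
      exact_mod_cast e5
    · have e1 := hlow v w
      have e2 : dist (f v) (f w) ≤ μ * T.dist (h v) (h w) + 3 * α := by
        linarith [(hqi (h v) (h w)).2]
      have e3 := mul_le_mul_of_nonneg_left e2 hμ0.le
      have e4 : μ * μ * (T.dist (h v) (h w) : ℝ) ≤ K * T.dist (h v) (h w) :=
        mul_le_mul_of_nonneg_right (by linarith) (Nat.cast_nonneg _)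
      have e5 : (T.dist v w : ℝ) ≤ K * T.dist (h v) (h w) + K := by linarith
      exact_mod_cast e5
  · have e1 := hlow (h x) y
    have e2 : dist (f (h x)) (f y) ≤ α + R := by
      have := dist_triangle (f (h x)) (φ (f x)) (f y)
      rw [dist_comm (f (h x)) (φ (f x))] at this
      linarith [hh x]
    have e3 := mul_le_mul_of_nonneg_left e2 hμ0.le
    have e5 : (T.dist (h x) y : ℝ) ≤ K := by linarith
    exact_mod_cast e5

theorem IsCoarselyHomogeneous.isBushy {T : SimpleGraph V} (hT : T.IsTree)
    (hfin : ∀ v, (T.neighborSet v).Finite) {K : ℕ} (hK : IsCoarselyHomogeneous T K) {v : V}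
    (hv : IsEssentialBranchingVertex T v) : IsBushy T := by
  obtain ⟨R, hR⟩ := hK.exists_isCoarselyBranching hT fun N =>
    ⟨v, hv.isBranching hT N⟩
  refine ⟨R, fun y => ?_⟩
  obtain ⟨q, u, hyq, hu, h⟩ :=
    exists_unboundedDirections hT hfin fun N => (hR y).exists_near_three hT N
  exact ⟨q, isEssentialBranchingVertex_of_directions hT hu h, hyq⟩

/-- **Remark following Theorem `mMSW`.** A bounded valency tree that is not bushy and is
quasi-isometric to a metric space with cobounded isometry group is either bounded or
contains a cobounded bi-infinite geodesic. -/
theorem nonbushy_tree_bounded_or_cobounded_geodesic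
    (T : SimpleGraph V) (htree : T.IsTree)
    (hval : ∃ D : ℕ, ∀ v : V, (T.neighborSet v).Finite ∧ (T.neighborSet v).ncard ≤ D)
    [MetricSpace Y]
    (hcobisom : ∃ R : ℝ, 0 ≤ R ∧ ∀ y₁ y₂ : Y, ∃ φ : Y ≃ᵢ Y, dist (φ y₁) y₂ ≤ R)
    (f : V → Y) (hf : IsGraphQuasiIsometry T f)
    (hnotbushy : ¬ IsBushy T) :
    (∃ B : ℕ, ∀ u w : V, T.dist u w ≤ B) ∨
    ∃ γ : ℤ → V, (∀ m n : ℤ, T.dist (γ m) (γ n) = (m - n).natAbs) ∧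
      ∃ r : ℕ, ∀ u : V, ∃ n : ℤ, T.dist u (γ n) ≤ r := by
  obtain ⟨K, hK⟩ := exists_isCoarselyHomogeneous T hcobisom f hf
  have hfin : ∀ v, (T.neighborSet v).Finite := fun v => (hval.choose_spec v).1
  rw [or_iff_not_imp_left]
  intro hunb
  push Not at hunb
  obtain ⟨R, hR⟩ := hK.exists_isCoarselyBranching htree
    (exists_far_pair_isBetween htree.connected hunb)
  have hdir : ∀ y, _ := fun y => exists_unboundedDirections htree hfin
    fun N => (hR y).exists_near_two htree.connected N
  obtain ⟨o, -⟩ := hunb 0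
  obtain ⟨_, _, -, hu, h⟩ := hdir o
  obtain ⟨γ, hγ⟩ := exists_isLine_of_directions htree hfin hu h
  refine ⟨γ, hγ, R, fun y => ?_⟩
  obtain ⟨q, u, hyq, hu, h⟩ := hdir y
  obtain ⟨k, hk⟩ := hγ.exists_projection htree q
  by_cases hne : γ k = q
  · exact ⟨k, by rwa [hne]⟩
  · exact absurd (hK.isBushy htree hfin
      ((hγ.isBranching_of_directions htree hu h hk hne).isEssentialBranchingVertex htree hfin))
      hnotbushy
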